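/- There exists a nonzero constant c ∈ ℚ such that the restriction of F to the 3-space W : X₆ = X₇ = 0 factors as F(X₀, X₁, X₂, X₃, 0, 0) = c · (X₀² − X₁² − X₂² − X₃²) · (X₀²X₁²X₂²X₃² − X₁⁴X₂⁴ − X₁⁴X₃⁴ − X₂⁴X₃⁴ + X₁⁴X₂²X₃² + X₁²X₂⁴X₃² + X₁²X₂²X₃⁴). In particular 𝒳 ∩ W is the union of the smooth quadric Q₆₇ : X₀² − X₁² − X₂² − X₃² = 0 and the degree-8 surface S₆₇ defined by the second factor. -/

import Mathlib

open MvPolynomial in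
/-- The degree-10 polynomial `F = F₁₀ − X₀X₁X₂X₃X₆X₇·F₄` defining the Picard modular
fourfold `𝒳 ⊂ P⁵`. The variables `X 0, X 1, X 2, X 3, X 4, X 5` stand for the
coordinates `X₀, X₁, X₂, X₃, X₆, X₇`, and `Sᵢ` is the `i`-th elementary symmetric
polynomial in the five squares `X₁², X₂², X₃², X₆², X₇²`. -/
noncomputable def Fpoly : MvPolynomial (Fin 6) ℚ :=
  let a := X 1 ^ 2; let b := X 2 ^ 2; let c := X 3 ^ 2; let d := X 4 ^ 2; let e := X 5 ^ 2
  let S1 := a + b + c + d + e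
  let S2 := a*b + a*c + a*d + a*e + b*c + b*d + b*e + c*d + c*e + d*e
  let S3 := a*b*c + a*b*d + a*b*e + a*c*d + a*c*e + a*d*e + b*c*d + b*c*e + b*d*e + c*d*e
  let S4 := a*b*c*d + a*b*c*e + a*b*d*e + a*c*d*e + b*c*d*e
  let S5 := a*b*c*d*e
  let F4 := -6*S1^2 + 16*S2 + 4*S1*(X 0)^2 + 2*(X 0)^4
  let F10 := S1*S2^2 - 3*S1^2*S3 + 12*S1*S4 - 48*S5 + (-S2^2 + 2*S1*S3 + 4*S4)*(X 0)^2
      + S3*(X 0)^4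
  F10 - X 0 * X 1 * X 2 * X 3 * X 4 * X 5 * F4

open MvPolynomial in
/-- There is a nonzero constant `c ∈ ℚ` such that the restriction of `F` to the
3-space `W : X₆ = X₇ = 0` factors as
`F(X₀,X₁,X₂,X₃,0,0) = c·(X₀² − X₁² − X₂² − X₃²)·(octic)`. In particular `𝒳 ∩ W` is
the union of the smooth quadric `Q₆₇ : X₀² − X₁² − X₂² − X₃² = 0` and the degree-8
surface `S₆₇` defined by the second factor. -/
theorem stmt_16 :
    ∃ c : ℚ, c ≠ 0 ∧
      aeval (![X 0, X 1, X 2, X 3, 0, 0] : Fin 6 → MvPolynomial (Fin 4) ℚ) Fpoly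
        = C c * ((X 0)^2 - (X 1)^2 - (X 2)^2 - (X 3)^2) *
            ((X 0)^2*(X 1)^2*(X 2)^2*(X 3)^2 - (X 1)^4*(X 2)^4 - (X 1)^4*(X 3)^4
              - (X 2)^4*(X 3)^4 + (X 1)^4*(X 2)^2*(X 3)^2 + (X 1)^2*(X 2)^4*(X 3)^2
              + (X 1)^2*(X 2)^2*(X 3)^4) := by
  refine ⟨1, one_ne_zero, ?_⟩
  simp [Fpoly, map_ofNat]
  ring
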